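/- Iterated time-shifted infeasibility. Let 1 ≤ s ≤ K−1 and suppose the binary sequence ν̂ = (ν̂[0],…,ν̂[K−1]) is such that (μ, ν̂) is trajectory-infeasible for every binary sequence μ ∈ ({0,1}^{n_μ})^K. Assume: (1) x₀ = A x₀; (2) for every j ∈ {0,…,s−1} there exists u ∈ ℝ^{n_u} with C x₀ + D u + H_ν ν̂[j] ≤ h componentwise; (3) for every index i ∈ {1,…,n_u}, the i-th column of B is zero or the i-th column of D is zero. Then for all vectors w[0],…,w[s−1] ∈ {0,1}^{n_ν}, the s-step shifted sequence (ν̂[s], ν̂[s+1], …, ν̂[K−1], w[0], …, w[s−1]) also makes the pair (μ, ·) trajectory-infeasible for every binary sequence μ ∈ ({0,1}^{n_μ})^K. -/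

import Mathlib

open Matrix

/-- A real vector is binary if every entry is `0` or `1`. -/
def IsBinaryVec {n : ℕ} (v : Fin n → ℝ) : Prop := ∀ i, v i = 0 ∨ v i = 1

/-- The pair `(μ, ν)` of binary sequences is trajectory-feasible: there exist states
`x[0..K]` and inputs `u[0..K-1]` with `x[0] = x₀`, the linear dynamics
`x[k+1] = A x[k] + B u[k] + G_μ μ[k]`, and the componentwise inequality constraints
`C x[k] + D u[k] + H_μ μ[k] + H_ν ν[k] ≤ h` for all `0 ≤ k ≤ K-1`. -/
def TrajFeasible (K n_x n_u nμ nν n_c : ℕ)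
    (A : Matrix (Fin n_x) (Fin n_x) ℝ) (B : Matrix (Fin n_x) (Fin n_u) ℝ)
    (Gμ : Matrix (Fin n_x) (Fin nμ) ℝ)
    (C : Matrix (Fin n_c) (Fin n_x) ℝ) (D : Matrix (Fin n_c) (Fin n_u) ℝ)
    (Hμ : Matrix (Fin n_c) (Fin nμ) ℝ) (Hν : Matrix (Fin n_c) (Fin nν) ℝ)
    (h : Fin n_c → ℝ) (x0 : Fin n_x → ℝ)
    (μ : Fin K → Fin nμ → ℝ) (ν : Fin K → Fin nν → ℝ) : Prop :=
  ∃ (x : Fin (K + 1) → Fin n_x → ℝ) (u : Fin K → Fin n_u → ℝ),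
    x 0 = x0 ∧
    (∀ k : Fin K, x k.succ = A.mulVec (x k.castSucc) + B.mulVec (u k) + Gμ.mulVec (μ k)) ∧
    (∀ k : Fin K, ∀ i,
      (C.mulVec (x k.castSucc) + D.mulVec (u k) + Hμ.mulVec (μ k) + Hν.mulVec (ν k)) i ≤ h i)

/-- If in each column index `B` or `D` vanishes, every input can be replaced by one with the same
image under `D` that lies in the kernel of `B`. -/
theorem exists_mulVec_eq_zero_and_mulVec_eq {m n p R : Type*} [Fintype p]
    [NonUnitalNonAssocSemiring R]
    (B : Matrix m p R) (D : Matrix n p R)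
    (hdisj : ∀ j, (∀ i, B i j = 0) ∨ (∀ i, D i j = 0)) (u : p → R) :
    ∃ v : p → R, B.mulVec v = 0 ∧ D.mulVec v = D.mulVec u := by
  classical
  refine ⟨fun j => if ∀ i, B i j = 0 then u j else 0, ?_, ?_⟩
  · ext i
    refine Finset.sum_eq_zero fun j _ => ?_
    by_cases hB : ∀ i, B i j = 0
    · simp [hB i]
    · simp [hB]
  · ext i
    refine Finset.sum_congr rfl fun j _ => ?_
    by_cases hB : ∀ i, B i j = 0
    · simp [hB]
    · simp [(hdisj j).resolve_left hB i]

/-- **Iterated time-shifted infeasibility.** Let `1 ≤ s ≤ K-1`. If `(μ, ν̂)` is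
trajectory-infeasible for every binary `μ`, the initial state is stationary (`A x₀ = x₀`),
the inequality constraint is satisfiable at the initial state for each of `ν̂[0], …, ν̂[s-1]`,
and the columns of `B` and `D` have disjoint supports, then for any binary vectors
`w[0], …, w[s-1]` the `s`-step shifted sequence `(ν̂[s], …, ν̂[K-1], w[0], …, w[s-1])`
is also trajectory-infeasible for every binary `μ`. -/
theorem iterated_time_shifted_infeasibility
    (K n_x n_u nμ nν n_c : ℕ) (hK : 0 < K)
    (s : ℕ) (hs1 : 1 ≤ s) (hs2 : s ≤ K - 1)
    (A : Matrix (Fin n_x) (Fin n_x) ℝ) (B : Matrix (Fin n_x) (Fin n_u) ℝ)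
    (Gμ : Matrix (Fin n_x) (Fin nμ) ℝ)
    (C : Matrix (Fin n_c) (Fin n_x) ℝ) (D : Matrix (Fin n_c) (Fin n_u) ℝ)
    (Hμ : Matrix (Fin n_c) (Fin nμ) ℝ) (Hν : Matrix (Fin n_c) (Fin nν) ℝ)
    (h : Fin n_c → ℝ) (x0 : Fin n_x → ℝ)
    (νhat : Fin K → Fin nν → ℝ) (hνbin : ∀ k, IsBinaryVec (νhat k))
    (hinf : ∀ μ : Fin K → Fin nμ → ℝ, (∀ k, IsBinaryVec (μ k)) →
      ¬ TrajFeasible K n_x n_u nμ nν n_c A B Gμ C D Hμ Hν h x0 μ νhat)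
    (hstat : A.mulVec x0 = x0)
    (hsat : ∀ j : Fin s, ∃ u : Fin n_u → ℝ,
      ∀ i, (C.mulVec x0 + D.mulVec u
        + Hν.mulVec (νhat ⟨(j : ℕ), by have := j.isLt; omega⟩)) i ≤ h i)
    (hdisj : ∀ j : Fin n_u, (∀ i, B i j = 0) ∨ (∀ i, D i j = 0))
    (w : Fin s → Fin nν → ℝ) (hw : ∀ j, IsBinaryVec (w j)) :
    ∀ μ : Fin K → Fin nμ → ℝ, (∀ k, IsBinaryVec (μ k)) →
      ¬ TrajFeasible K n_x n_u nμ nν n_c A B Gμ C D Hμ Hν h x0 μ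
        (fun k => if hk : (k : ℕ) + s < K then νhat ⟨(k : ℕ) + s, hk⟩
          else w ⟨(k : ℕ) + s - K, by have := k.isLt; omega⟩) := by
  rintro μ hμ ⟨x, u, hx0, hdyn, hcon⟩
  have hsat' : ∀ j : Fin s, ∃ u : Fin n_u → ℝ, B.mulVec u = 0 ∧
      ∀ i, (C.mulVec x0 + D.mulVec u
        + Hν.mulVec (νhat ⟨(j : ℕ), by have := j.isLt; omega⟩)) i ≤ h i := fun j => by
    obtain ⟨v, hv⟩ := hsat j
    obtain ⟨v', hB, hD⟩ := exists_mulVec_eq_zero_and_mulVec_eq B D hdisj v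
    exact ⟨v', hB, by rwa [hD]⟩
  choose v hvB hv using hsat'
  refine hinf (fun k => if (k : ℕ) < s then 0 else μ ⟨k - s, by omega⟩) (fun k => ?_)
    ⟨fun k => if (k : ℕ) < s then x0 else x ⟨k - s, by omega⟩,
      fun k => if hk : (k : ℕ) < s then v ⟨k, hk⟩ else u ⟨k - s, by omega⟩, ?_, fun k => ?_,
      fun k => ?_⟩
  · split_ifs
    · exact fun _ => Or.inl rfl
    · exact hμ _
  · simp [show 0 < s from hs1]
  · by_cases hk : (k : ℕ) < s
    · have hnext : (if (k.succ : ℕ) < s then x0 else x ⟨k.succ - s, by omega⟩) = x0 := by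
        split_ifs with hk'
        · rfl
        · rw [← hx0]
          congr 1
          ext
          simp only [Fin.val_succ, Fin.val_zero] at hk' ⊢
          omega
      simp only [hnext, Fin.val_castSucc, hk, if_true, dif_pos, hvB, hstat, mulVec_zero, add_zero]
    · have hk' : ¬ (k : ℕ) + 1 < s := by omega
      simp only [Fin.val_succ, Fin.val_castSucc, hk, hk', if_false, dif_neg, not_false_eq_true]
      rw [← Fin.castSucc_mk K (k - s) (by omega), ← hdyn]
      congr 1
      ext
      simp only [Fin.val_succ]
      omega
  · by_cases hk : (k : ℕ) < s
    · simpa [hk] using hv ⟨k, hk⟩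
    · have hlt : (k : ℕ) - s + s < K := by omega
      have hidx : (⟨(k : ℕ) - s + s, hlt⟩ : Fin K) = k := by
        ext
        simp only
        omega
      have hshift := hcon ⟨k - s, by omega⟩
      simp only [hlt, dif_pos, hidx, Fin.castSucc_mk] at hshift
      simpa only [Fin.val_castSucc, hk, if_false, dif_neg, not_false_eq_true] using hshift
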